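/- Let Ω_1,...,Ω_m be a partition of [n] into disjoint nonempty sets and let G = {σ ∈ Sym([n]) : σ(Ω_i) = Ω_i for all i = 1,...,m} be the corresponding direct product of symmetric groups Sym(Ω_1) × ... × Sym(Ω_m). Then for every system V of subsets V_1,...,V_n of [n], if G satisfies the orbit condition subject to V then G has a G-marriage subject to V. -/

import Mathlib

/-- `G` has a `G`-marriage subject to `V`: some `g ∈ G` satisfies `g i ∈ V i` for all `i`. -/
def hasMarriage {n : ℕ} (G : Subgroup (Equiv.Perm (Fin n))) (V : Fin n → Set (Fin n)) : Prop :=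
  ∃ g ∈ G, ∀ i, g i ∈ V i

/-- The orbit condition: for every nonempty `Y ⊆ [n]` there is `g ∈ G` with `Y^g ⊆ ⋃_{y ∈ Y} V y`. -/
def orbitCondition {n : ℕ} (G : Subgroup (Equiv.Perm (Fin n))) (V : Fin n → Set (Fin n)) : Prop :=
  ∀ Y : Set (Fin n), Y.Nonempty → ∃ g ∈ G, (⇑g) '' Y ⊆ ⋃ y ∈ Y, V y

/-- The `k`-orbit condition: for every nonempty set `Y` of `k`-tuples there is `g ∈ G` such that
`Y^g ⊆ ⋃_{y ∈ Y} V_{y 0} × ⋯ × V_{y (k-1)}`. -/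
def kOrbitCondition {n : ℕ} (k : ℕ) (G : Subgroup (Equiv.Perm (Fin n))) (V : Fin n → Set (Fin n)) : Prop :=
  ∀ Y : Set (Fin k → Fin n), Y.Nonempty →
    ∃ g ∈ G, ∀ y ∈ Y, ∃ z ∈ Y, ∀ j, g (y j) ∈ V (z j)

open Classical in
/-- Hall's theorem along the fibres of a map `c`: if for every nonempty `Y` inside a single fibre some
fibre-preserving injection maps `Y` into `⋃ y ∈ Y, V y`, then some fibre-preserving permutation
maps each `x` into `V x`. -/
theorem exists_perm_fiberwise_mem {α β : Type*} [Fintype α] [Fintype β] (c : α → β)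
    (V : α → Set α)
    (h : ∀ (b : β) (Y : Finset α), Y.Nonempty → (∀ y ∈ Y, c y = b) →
      ∃ g : α → α, g.Injective ∧ (∀ x, c (g x) = c x) ∧ ∀ y ∈ Y, ∃ z ∈ Y, g y ∈ V z) :
    ∃ σ : Equiv.Perm α, ∀ x, c (σ x) = c x ∧ σ x ∈ V x := by
  let t : α → Finset α := fun x => Finset.univ.filter fun y => c y = c x ∧ y ∈ V x
  have hall : ∀ s : Finset α, s.card ≤ (s.biUnion t).card := by
    intro s
    rw [Finset.card_eq_sum_card_fiberwise (f := c) (t := Finset.univ) (by simp),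
      Finset.card_eq_sum_card_fiberwise (s := s.biUnion t) (f := c) (t := Finset.univ) (by simp)]
    refine Finset.sum_le_sum fun b _ => ?_
    rcases (s.filter fun x => c x = b).eq_empty_or_nonempty with hs | hs
    · simp [hs]
    obtain ⟨g, hg, hgc, hgV⟩ := h b _ hs fun y hy => (Finset.mem_filter.1 hy).2
    refine Finset.card_le_card_of_injOn g (fun y hy => ?_) hg.injOn
    obtain ⟨z, hz, hyz⟩ := hgV y hy
    have hyb := (Finset.mem_filter.1 hy).2
    obtain ⟨hzs, hzb⟩ := Finset.mem_filter.1 hz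
    exact Finset.mem_filter.2 ⟨Finset.mem_biUnion.2 ⟨z, hzs, by simp [t, hgc, hyb, hzb, hyz]⟩,
      (hgc y).trans hyb⟩
  obtain ⟨f, hf, hft⟩ := (Finset.all_card_le_biUnion_card_iff_exists_injective t).1 hall
  exact ⟨Equiv.ofBijective f (Finite.injective_iff_bijective.1 hf), fun x => by
    simpa [t] using hft x⟩

/-- If `G` is the direct product of symmetric groups coming from a partition of `[n]`
into disjoint nonempty sets, then the orbit condition is sufficient for the
`G`-Marriage Problem. -/
theorem stmt_10 (n m : ℕ) (Ω : Fin m → Set (Fin n))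
    (hne : ∀ i, (Ω i).Nonempty)
    (hdisj : ∀ i j, i ≠ j → Disjoint (Ω i) (Ω j))
    (hcover : (⋃ i, Ω i) = Set.univ)
    (G : Subgroup (Equiv.Perm (Fin n)))
    (hG : ∀ σ : Equiv.Perm (Fin n), σ ∈ G ↔ ∀ i, (⇑σ) '' Ω i = Ω i)
    (V : Fin n → Set (Fin n)) (h : orbitCondition G V) :
    hasMarriage G V := by
  have hex : ∀ x, ∃ i, x ∈ Ω i := fun x => by
    simpa using hcover.symm.subset (Set.mem_univ x)
  choose c hc using hex
  have hmem : ∀ x i, x ∈ Ω i ↔ c x = i := fun x i =>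
    ⟨fun hx => by_contra fun hne => Set.disjoint_left.1 (hdisj _ _ hne) (hc x) hx,
      fun hx => hx ▸ hc x⟩
  have hG' : ∀ σ : Equiv.Perm (Fin n), σ ∈ G ↔ ∀ x, c (σ x) = c x := by
    intro σ
    rw [hG]
    constructor
    · intro hσ x
      exact (hmem _ _).1 ((hσ (c x)).subset (Set.mem_image_of_mem σ (hc x)))
    · intro hσ i
      ext y
      rw [Equiv.image_eq_preimage_symm, Set.mem_preimage, hmem, hmem, ← hσ, Equiv.apply_symm_apply]
  obtain ⟨σ, hσ⟩ := exists_perm_fiberwise_mem c V fun b Y hY _ => by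
    obtain ⟨g, hg, hgY⟩ := h Y hY
    refine ⟨g, g.injective, (hG' g).1 hg, fun y hy => ?_⟩
    simpa using hgY (Set.mem_image_of_mem g hy)
  exact ⟨σ, (hG' σ).2 fun x => (hσ x).1, fun x => (hσ x).2⟩
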